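/- arXiv:1406.5430 — 2 statements merged into one kernel-verified Lean document; each statement's English description precedes it below -/
import Mathlib

section
/- The weighted L² error of the linear spline approximation of the payoff f satisfies sqrt( Σ_{i=0}^{n−1} ∫_{X_i}^{X_{i+1}} (L_i(S) − f(S))² g(S) dS ) ≤ sqrt( 2 Σ_{i=0}^{n−1} h_i⁴ ∫_{X_i}^{X_{i+1}} G(S) (f″(S))² dS ). -/
open MeasureTheory intervalIntegral

/-- `Ĝ_i` transported to the subinterval `[a, b]`:
`G(S) = Ĝ_i((S - a)/(b - a))` where `ĝ_i(ξ) = g(a + (b - a)ξ)` and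
`Ĝ_i(t) = ∫_0^t ĝ_i(ξ) ξ²(1-ξ)³/3 dξ + ∫_t^1 ĝ_i(ξ) (1-ξ)²ξ³/3 dξ`. -/
noncomputable def weightG (g : ℝ → ℝ) (a b S : ℝ) : ℝ :=
    (∫ ξ in (0:ℝ)..((S - a) / (b - a)), g (a + (b - a) * ξ) * (ξ ^ 2 * (1 - ξ) ^ 3 / 3))
  + (∫ ξ in ((S - a) / (b - a))..(1:ℝ), g (a + (b - a) * ξ) * ((1 - ξ) ^ 2 * ξ ^ 3 / 3))

/-- Linear interpolant of `f` on `[a, b]`: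
`L(S) = ((b - S)/(b - a)) f(a) + ((S - a)/(b - a)) f(b)`. -/
noncomputable def splineL (f : ℝ → ℝ) (a b S : ℝ) : ℝ :=
  ((b - S) / (b - a)) * f a + ((S - a) / (b - a)) * f b

lemma aux_cs (φ p : ℝ → ℝ) (hφ : Continuous φ) (hp : Continuous p) (c d : ℝ) (hcd : c ≤ d) :
    (∫ t in c..d, φ t * p t) ^ 2 ≤ (∫ t in c..d, φ t ^ 2) * ∫ t in c..d, p t ^ 2 := by
  have h : ∀ s : ℝ, 0 ≤ (∫ t in c..d, φ t ^ 2) * (s * s) + (2 * ∫ t in c..d, φ t * p t) * s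
      + ∫ t in c..d, p t ^ 2 := by
    intro s
    have h0 : 0 ≤ ∫ t in c..d, (φ t * s + p t) ^ 2 :=
      intervalIntegral.integral_nonneg hcd (fun t _ => sq_nonneg _)
    have h1 : ∫ t in c..d, (φ t * s + p t) ^ 2 =
        ∫ t in c..d, (φ t ^ 2 * (s * s) + φ t * p t * (2 * s) + p t ^ 2) := by
      congr 1; ext t; ring
    rw [h1, intervalIntegral.integral_add, intervalIntegral.integral_add,
      intervalIntegral.integral_mul_const, intervalIntegral.integral_mul_const] at h0
    · linarith
    all_goals exact Continuous.intervalIntegrable (by fun_prop) _ _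
  have := discrim_le_zero h
  unfold discrim at this
  nlinarith

/-- Fubini on a triangle, by parts. -/
lemma aux_fub1 (w q : ℝ → ℝ) (hw : Continuous w) (hq : Continuous q) :
    ∫ t in (0:ℝ)..1, w t * (∫ s in (0:ℝ)..t, q s) =
      ∫ t in (0:ℝ)..1, (∫ s in t..1, w s) * q t := by
  have hA : ∀ t, HasDerivAt (fun t => ∫ s in (0:ℝ)..t, q s) (q t) t :=
    fun t => hq.integral_hasStrictDerivAt 0 t |>.hasDerivAt
  have hW : ∀ t, HasDerivAt (fun t => ∫ s in t..(1:ℝ), w s) (-w t) t := by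
    intro t
    have h := (hw.integral_hasStrictDerivAt 1 t).hasDerivAt.neg
    refine h.congr_of_eventuallyEq (Filter.Eventually.of_forall fun x => ?_)
    exact intervalIntegral.integral_symm 1 x
  have cA : Continuous (fun t => ∫ s in (0:ℝ)..t, q s) :=
    continuous_iff_continuousAt.2 fun t => (hA t).continuousAt
  have cW : Continuous (fun t => ∫ s in t..(1:ℝ), w s) :=
    continuous_iff_continuousAt.2 fun t => (hW t).continuousAt
  have := intervalIntegral.integral_eq_sub_of_hasDerivAt (a := 0) (b := 1)
    (fun t _ => (hW t).mul (hA t))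
    (Continuous.intervalIntegrable (by fun_prop) _ _)
  rw [intervalIntegral.integral_add
    (Continuous.intervalIntegrable (by fun_prop) _ _)
    (Continuous.intervalIntegrable (by fun_prop) _ _)] at this
  simp only [Pi.mul_apply, intervalIntegral.integral_same, neg_mul, intervalIntegral.integral_neg] at this
  linarith

lemma aux_fub2 (w q : ℝ → ℝ) (hw : Continuous w) (hq : Continuous q) :
    ∫ t in (0:ℝ)..1, w t * (∫ s in t..1, q s) =
      ∫ t in (0:ℝ)..1, (∫ s in (0:ℝ)..t, w s) * q t := by
  have := aux_fub1 q w hq hw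
  simp only [mul_comm] at this ⊢
  exact this.symm

lemma aux_cont1 (q : ℝ → ℝ) (hq : Continuous q) : Continuous (fun t => ∫ s in (0:ℝ)..t, q s) :=
  continuous_iff_continuousAt.2 fun t => (hq.integral_hasStrictDerivAt 0 t).hasDerivAt.continuousAt

lemma aux_cont2 (q : ℝ → ℝ) (hq : Continuous q) : Continuous (fun t => ∫ s in t..(1:ℝ), q s) := by
  have := (continuous_iff_continuousAt.2 fun t =>
    (hq.integral_hasStrictDerivAt 1 t).hasDerivAt.continuousAt).neg
  refine this.congr fun x => ?_
  exact (intervalIntegral.integral_symm 1 x).symm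

lemma aux_unit (p γ e : ℝ → ℝ) (hp : Continuous p) (hγ : Continuous γ) (hγ0 : ∀ t, 0 ≤ γ t)
    (he : ∀ x ∈ Set.Icc (0:ℝ) 1, e x = (1 - x) * (∫ t in (0:ℝ)..x, t * p t)
      + x * ∫ t in x..1, (1 - t) * p t) :
    ∫ x in (0:ℝ)..1, (e x) ^ 2 * γ x ≤
      2 * ∫ t in (0:ℝ)..1, ((∫ ξ in (0:ℝ)..t, γ ξ * (ξ ^ 2 * (1 - ξ) ^ 3 / 3))
        + (∫ ξ in t..(1:ℝ), γ ξ * ((1 - ξ) ^ 2 * ξ ^ 3 / 3))) * p t ^ 2 := by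
  have hp2 : Continuous (fun t => p t ^ 2) := by fun_prop
  have hw1 : Continuous (fun ξ => γ ξ * (ξ ^ 2 * (1 - ξ) ^ 3 / 3)) := by fun_prop
  have hw2 : Continuous (fun ξ => γ ξ * ((1 - ξ) ^ 2 * ξ ^ 3 / 3)) := by fun_prop
  have c1 := aux_cont1 _ hp2
  have c2 := aux_cont2 _ hp2
  have c3 := aux_cont1 _ hw1
  have c4 := aux_cont2 _ hw2
  have c5 := aux_cont1 (fun t => t * p t) (by fun_prop)
  have c6 := aux_cont2 (fun t => (1 - t) * p t) (by fun_prop)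
  simp only [add_mul]
  rw [intervalIntegral.integral_add
    (Continuous.intervalIntegrable (by fun_prop) _ _)
    (Continuous.intervalIntegrable (by fun_prop) _ _),
    ← aux_fub2 _ _ hw1 hp2, ← aux_fub1 _ _ hw2 hp2,
    ← intervalIntegral.integral_add
    (Continuous.intervalIntegrable (by fun_prop) _ _)
    (Continuous.intervalIntegrable (by fun_prop) _ _),
    ← intervalIntegral.integral_const_mul]
  have hc : ∫ x in (0:ℝ)..1, (e x) ^ 2 * γ x = ∫ x in (0:ℝ)..1,
      ((1 - x) * (∫ t in (0:ℝ)..x, t * p t) + x * ∫ t in x..1, (1 - t) * p t) ^ 2 * γ x := by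
    apply intervalIntegral.integral_congr
    intro x hx
    rw [Set.uIcc_of_le zero_le_one] at hx
    simp only [he x hx]
  rw [hc]
  apply intervalIntegral.integral_mono_on zero_le_one
    (Continuous.intervalIntegrable (by fun_prop) _ _)
    (Continuous.intervalIntegrable (by fun_prop) _ _)
  intro x hx
  have k1 := aux_cs (fun t => t) p (by fun_prop) hp 0 x hx.1
  have k2 := aux_cs (fun t => 1 - t) p (by fun_prop) hp x 1 hx.2
  have i1 : ∫ t in (0:ℝ)..x, t ^ 2 = x ^ 3 / 3 := by
    rw [integral_pow]; norm_num
  have i2 : ∫ t in x..(1:ℝ), (1 - t) ^ 2 = (1 - x) ^ 3 / 3 := by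
    rw [intervalIntegral.integral_comp_sub_left (fun t => t ^ 2), integral_pow]; norm_num
  simp only [i1] at k1
  simp only [i2] at k2
  set A := ∫ t in (0:ℝ)..x, t * p t
  set B := ∫ t in x..(1:ℝ), (1 - t) * p t
  set C := ∫ t in (0:ℝ)..x, p t ^ 2
  set D := ∫ t in x..(1:ℝ), p t ^ 2
  have m1 := mul_le_mul_of_nonneg_left k1 (sq_nonneg (1 - x))
  have m2 := mul_le_mul_of_nonneg_left k2 (sq_nonneg x)
  have m3 : ((1 - x) * A + x * B) ^ 2 ≤
      2 * ((1 - x) ^ 2 * (x ^ 3 / 3 * C)  + x ^ 2 * ((1 - x) ^ 3 / 3 * D)) := by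
    nlinarith [sq_nonneg ((1 - x) * A - x * B)]
  have m4 := mul_le_mul_of_nonneg_right m3 (hγ0 x)
  refine m4.trans (le_of_eq ?_)
  ring

lemma aux_rep (u u' p : ℝ → ℝ) (hu : ContinuousOn u (Set.Icc 0 1))
    (hu' : ContinuousOn u' (Set.Icc 0 1)) (hp : Continuous p)
    (h1 : ∀ t ∈ Set.Ioo (0:ℝ) 1, HasDerivAt u (u' t) t)
    (h2 : ∀ t ∈ Set.Ioo (0:ℝ) 1, HasDerivAt u' (p t) t) :
    ∀ x ∈ Set.Icc (0:ℝ) 1, (1 - x) * u 0 + x * u 1 - u x =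
      (1 - x) * (∫ t in (0:ℝ)..x, t * p t) + x * ∫ t in x..1, (1 - t) * p t := by
  intro x hx
  have e1 : ∫ t in (0:ℝ)..x, t * p t = (x * u' x - u x) - (0 * u' 0 - u 0) := by
    have hs : Set.Icc 0 x ⊆ Set.Icc (0:ℝ) 1 := Set.Icc_subset_Icc_right hx.2
    apply intervalIntegral.integral_eq_sub_of_hasDerivAt_of_le (f := fun t => t * u' t - u t) hx.1
    · have := hu.mono hs
      have := hu'.mono hs
      fun_prop
    · intro t ht
      have ht' : t ∈ Set.Ioo (0:ℝ) 1 := ⟨ht.1, ht.2.trans_le hx.2⟩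
      exact (((hasDerivAt_id t).mul (h2 t ht')).sub (h1 t ht')).congr_deriv (by simp)
    · exact Continuous.intervalIntegrable (by fun_prop) _ _
  have e2 : ∫ t in x..(1:ℝ), (1 - t) * p t =
      ((1 - 1) * u' 1 + u 1) - ((1 - x) * u' x + u x) := by
    have hs : Set.Icc x 1 ⊆ Set.Icc (0:ℝ) 1 := Set.Icc_subset_Icc_left hx.1
    apply intervalIntegral.integral_eq_sub_of_hasDerivAt_of_le
      (f := fun t => (1 - t) * u' t + u t) hx.2
    · have := hu.mono hs
      have := hu'.mono hs
      fun_prop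
    · intro t ht
      have ht' : t ∈ Set.Ioo (0:ℝ) 1 := ⟨hx.1.trans_lt ht.1, ht.2⟩
      exact ((((hasDerivAt_id t).const_sub 1).mul (h2 t ht')).add (h1 t ht')).congr_deriv
        (by simp only [id]; ring)
    · exact Continuous.intervalIntegrable (by fun_prop) _ _
  rw [e1, e2]
  ring

lemma aux_piece (f g : ℝ → ℝ) (a b : ℝ) (hab : a < b)
    (hf2 : ContDiffOn ℝ 2 f (Set.Icc a b))
    (hg0 : ∀ S ∈ Set.Icc a b, 0 ≤ g S) (hgc : ContinuousOn g (Set.Icc a b)) :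
    ∫ S in a..b, (splineL f a b S - f S) ^ 2 * g S ≤
      2 * ((b - a) ^ 4 * ∫ S in a..b, weightG g a b S * (deriv (deriv f) S) ^ 2) := by
  have hh : 0 < b - a := sub_pos.2 hab
  have hh0 : b - a ≠ 0 := hh.ne'
  have hud := uniqueDiffOn_Icc hab
  set D := derivWithin f (Set.Icc a b) with hD
  have hDc : ContDiffOn ℝ 1 D (Set.Icc a b) := hf2.derivWithin hud (by norm_num)
  set P := derivWithin D (Set.Icc a b) with hP
  have hPc : ContinuousOn P (Set.Icc a b) := hDc.continuousOn_derivWithin hud (by norm_num)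
  have d1 : ∀ x ∈ Set.Ioo a b, HasDerivAt f (D x) x := fun x hx =>
    ((hf2.differentiableOn (by norm_num)) x (Set.Ioo_subset_Icc_self hx)).hasDerivWithinAt.hasDerivAt
      (Icc_mem_nhds hx.1 hx.2)
  have d2 : ∀ x ∈ Set.Ioo a b, HasDerivAt D (P x) x := fun x hx =>
    ((hDc.differentiableOn (by norm_num)) x (Set.Ioo_subset_Icc_self hx)).hasDerivWithinAt.hasDerivAt
      (Icc_mem_nhds hx.1 hx.2)
  have d3 : ∀ x ∈ Set.Ioo a b, deriv (deriv f) x = P x := by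
    intro x hx
    have : deriv f =ᶠ[nhds x] D := by
      filter_upwards [Ioo_mem_nhds hx.1 hx.2] with y hy using (d1 y hy).deriv
    rw [this.deriv_eq, (d2 x hx).deriv]
  have maps : ∀ t ∈ Set.Icc (0:ℝ) 1, a + (b - a) * t ∈ Set.Icc a b := by
    intro t ht
    constructor <;> nlinarith [ht.1, ht.2]
  have maps' : ∀ t ∈ Set.Ioo (0:ℝ) 1, a + (b - a) * t ∈ Set.Ioo a b := by
    intro t ht
    constructor <;> nlinarith [ht.1, ht.2]
  have hφ : ContinuousOn (fun t : ℝ => a + (b - a) * t) (Set.Icc 0 1) := by fun_prop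
  set p : ℝ → ℝ := Set.IccExtend (zero_le_one' ℝ)
    ((Set.Icc (0:ℝ) 1).domRestrict (fun t => (b - a) ^ 2 * P (a + (b - a) * t))) with hpd
  have hp : Continuous p := by
    apply Continuous.Icc_extend'
    apply ContinuousOn.domRestrict
    exact continuousOn_const.mul (hPc.comp hφ maps)
  have hpe : ∀ t ∈ Set.Icc (0:ℝ) 1, p t = (b - a) ^ 2 * P (a + (b - a) * t) := fun t ht => by
    rw [hpd, Set.IccExtend_of_mem _ _ ht]; rfl
  set γ : ℝ → ℝ := Set.IccExtend (zero_le_one' ℝ)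
    ((Set.Icc (0:ℝ) 1).domRestrict (fun t => g (a + (b - a) * t))) with hγd
  have hγ : Continuous γ := by
    apply Continuous.Icc_extend'
    apply ContinuousOn.domRestrict
    exact hgc.comp hφ maps
  have hγe : ∀ t ∈ Set.Icc (0:ℝ) 1, γ t = g (a + (b - a) * t) := fun t ht => by
    rw [hγd, Set.IccExtend_of_mem _ _ ht]; rfl
  have hγ0 : ∀ t, 0 ≤ γ t := by
    intro t
    exact hg0 _ (maps _ (Set.projIcc (0:ℝ) 1 zero_le_one t).2)
  have hlin : ∀ t : ℝ, HasDerivAt (fun t : ℝ => a + (b - a) * t) (b - a) t := fun t => by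
    simpa using ((hasDerivAt_id t).const_mul (b - a)).const_add a
  have rep := aux_rep (fun t => f (a + (b - a) * t)) (fun t => (b - a) * D (a + (b - a) * t)) p
    (hf2.continuousOn.comp hφ maps) (continuousOn_const.mul (hDc.continuousOn.comp hφ maps)) hp
    (fun t ht => by
      have := (d1 _ (maps' t ht)).comp t (hlin t)
      rw [mul_comm] at this
      exact this)
    (fun t ht => by
      have := ((d2 _ (maps' t ht)).comp t (hlin t)).const_mul (b - a)
      rw [hpe t (Set.Ioo_subset_Icc_self ht)]
      exact this.congr_deriv (by ring))
  have key := aux_unit p γ _ hp hγ hγ0 rep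
  have cv : ∀ F : ℝ → ℝ, ∫ S in a..b, F S = (b - a) * ∫ t in (0:ℝ)..1, F (a + (b - a) * t) := by
    intro F
    rw [intervalIntegral.mul_integral_comp_add_mul]
    simp
  have hL : ∫ S in a..b, (splineL f a b S - f S) ^ 2 * g S = (b - a) * ∫ x in (0:ℝ)..1,
      ((1 - x) * f (a + (b - a) * 0) + x * f (a + (b - a) * 1) - f (a + (b - a) * x)) ^ 2
        * γ x := by
    rw [cv]
    congr 1
    apply intervalIntegral.integral_congr
    intro t ht
    rw [Set.uIcc_of_le zero_le_one] at ht
    simp only [hγe t ht, splineL]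
    have z1 : (b - (a + (b - a) * t)) / (b - a) = 1 - t := by field_simp; ring
    have z2 : (a + (b - a) * t - a) / (b - a) = t := by field_simp; ring
    rw [z1, z2]
    simp
  have hR : (b - a) ^ 4 * ∫ S in a..b, weightG g a b S * (deriv (deriv f) S) ^ 2 =
      (b - a) * ∫ t in (0:ℝ)..1, ((∫ ξ in (0:ℝ)..t, γ ξ * (ξ ^ 2 * (1 - ξ) ^ 3 / 3))
        + (∫ ξ in t..(1:ℝ), γ ξ * ((1 - ξ) ^ 2 * ξ ^ 3 / 3))) * p t ^ 2 := by
    rw [cv, mul_left_comm, ← intervalIntegral.integral_const_mul]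
    congr 1
    apply intervalIntegral.integral_congr_Ioo_of_le zero_le_one
    intro t ht
    have ht' := Set.Ioo_subset_Icc_self ht
    have z2 : (a + (b - a) * t - a) / (b - a) = t := by field_simp; ring
    simp only [weightG, z2, d3 _ (maps' t ht), hpe t ht']
    have j1 : ∫ ξ in (0:ℝ)..t, g (a + (b - a) * ξ) * (ξ ^ 2 * (1 - ξ) ^ 3 / 3) =
        ∫ ξ in (0:ℝ)..t, γ ξ * (ξ ^ 2 * (1 - ξ) ^ 3 / 3) := by
      apply intervalIntegral.integral_congr
      intro ξ hξ
      rw [Set.uIcc_of_le ht'.1] at hξ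
      simp only [hγe ξ ⟨hξ.1, hξ.2.trans ht'.2⟩]
    have j2 : ∫ ξ in t..(1:ℝ), g (a + (b - a) * ξ) * ((1 - ξ) ^ 2 * ξ ^ 3 / 3) =
        ∫ ξ in t..(1:ℝ), γ ξ * ((1 - ξ) ^ 2 * ξ ^ 3 / 3) := by
      apply intervalIntegral.integral_congr
      intro ξ hξ
      rw [Set.uIcc_of_le ht'.2] at hξ
      simp only [hγe ξ ⟨ht'.1.trans hξ.1, hξ.2⟩]
    rw [j1, j2]
    ring
  rw [hL, hR]
  have := mul_le_mul_of_nonneg_left key hh.le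
  linarith

/-- The weighted L² error of the linear spline approximation of the payoff `f` satisfies
`sqrt(Σ_i ∫_{X_i}^{X_{i+1}} (L_i(S) − f(S))² g(S) dS)
  ≤ sqrt(2 Σ_i h_i⁴ ∫_{X_i}^{X_{i+1}} G(S) (f″(S))² dS)`. -/
theorem spline_error_bound
    (n : ℕ) (hn : 1 ≤ n) (X : ℕ → ℝ) (hX0 : 0 < X 0)
    (hXmono : ∀ i < n, X i < X (i + 1))
    (f g : ℝ → ℝ)
    (hf : ContinuousOn f (Set.Icc (X 0) (X n)))
    (hf2 : ∀ i < n, ContDiffOn ℝ 2 f (Set.Icc (X i) (X (i + 1))))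
    (hg0 : ∀ S ∈ Set.Icc (X 0) (X n), 0 ≤ g S)
    (hgc : ContinuousOn g (Set.Icc (X 0) (X n))) :
    Real.sqrt (∑ i ∈ Finset.range n,
        ∫ S in (X i)..(X (i + 1)), (splineL f (X i) (X (i + 1)) S - f S) ^ 2 * g S)
    ≤ Real.sqrt (2 * ∑ i ∈ Finset.range n, (X (i + 1) - X i) ^ 4 *
        ∫ S in (X i)..(X (i + 1)),
          weightG g (X i) (X (i + 1)) S * (deriv (deriv f) S) ^ 2) := by
  apply Real.sqrt_le_sqrt
  rw [Finset.mul_sum]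
  apply Finset.sum_le_sum
  intro i hi
  have hi' : i < n := Finset.mem_range.1 hi
  have up : ∀ k, k ≤ n → X 0 ≤ X k := by
    intro k
    induction k with
    | zero => intro _; exact le_rfl
    | succ k ih => intro hk; exact (ih (by omega)).trans (hXmono k (by omega)).le
  have dn : ∀ k, i + 1 + k ≤ n → X (i + 1) ≤ X (i + 1 + k) := by
    intro k
    induction k with
    | zero => intro _; exact le_rfl
    | succ k ih => intro hk; exact (ih (by omega)).trans (hXmono (i + 1 + k) (by omega)).le
  have hn' : X (i + 1) ≤ X n := by
    have := dn (n - (i + 1)) (by omega)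
    rwa [Nat.add_sub_cancel' hi'] at this
  have hs : Set.Icc (X i) (X (i + 1)) ⊆ Set.Icc (X 0) (X n) :=
    Set.Icc_subset_Icc (up i hi'.le) hn'
  exact aux_piece f g _ _ (hXmono i hi') (hf2 i hi') (fun S hS => hg0 S (hs hS)) (hgc.mono hs)
end

section
/- For every γ ∈ (0, 2], the weighted squared spline-approximation error satisfies Σ_{i=0}^{n−1} ∫_{X_i}^{X_{i+1}} (L_i(S) − f(S))² g(S) dS ≤ 2 α_h Σ_{i=0}^{n−1} h_i⁵ ρ_i^{2/γ}. -/
open MeasureTheory intervalIntegral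

/-- The weighted curvature integral `∫_a^b G(S) (f″(S))² dS` on a subinterval `[a, b]`. -/
noncomputable def curvInt (f g : ℝ → ℝ) (a b : ℝ) : ℝ :=
  ∫ S in a..b, weightG g a b S * (deriv (deriv f) S) ^ 2

/-- The intensity parameter
`α_h = [(1/(X_n − X_0)) Σ_i h_i ((1/h_i) ∫_{X_i}^{X_{i+1}} G(S)(f″(S))² dS)^{γ/2}]^{2/γ}`. -/
noncomputable def alphaH (f g : ℝ → ℝ) (γ : ℝ) (n : ℕ) (X : ℕ → ℝ) : ℝ :=
  ((1 / (X n - X 0)) * ∑ i ∈ Finset.range n, (X (i + 1) - X i) *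
      ((1 / (X (i + 1) - X i)) * curvInt f g (X i) (X (i + 1))) ^ (γ / 2)) ^ (2 / γ)

/-- The adaptation function
`ρ_i = (1 + (1/(α_h h_i)) ∫_{X_i}^{X_{i+1}} G(S)(f″(S))² dS)^{γ/2}`. -/
noncomputable def rhoAdapt (f g : ℝ → ℝ) (γ : ℝ) (n : ℕ) (X : ℕ → ℝ) (i : ℕ) : ℝ :=
  (1 + (1 / (alphaH f g γ n X * (X (i + 1) - X i))) * curvInt f g (X i) (X (i + 1))) ^ (γ / 2)

lemma aux_cs_s4 (p q : ℝ → ℝ) (hp : Continuous p) (hq : Continuous q) (a b : ℝ) (hab : a ≤ b) :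
    (∫ x in a..b, p x * q x) ^ 2 ≤ (∫ x in a..b, p x ^ 2) * ∫ x in a..b, q x ^ 2 := by
  have key : ∀ c : ℝ, 0 ≤ (∫ x in a..b, p x ^ 2) * (c * c)
      + (-2 * ∫ x in a..b, p x * q x) * c + ∫ x in a..b, q x ^ 2 := by
    intro c
    have h0 : 0 ≤ ∫ x in a..b, (q x - c * p x) ^ 2 :=
      intervalIntegral.integral_nonneg hab (fun x _ => sq_nonneg _)
    have h1 : (∫ x in a..b, (q x - c * p x) ^ 2)
        = ∫ x in a..b, ((c * c) * p x ^ 2 + (-2 * c) * (p x * q x) + q x ^ 2) := by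
      congr 1; ext x; ring
    rw [h1, intervalIntegral.integral_add, intervalIntegral.integral_add,
      intervalIntegral.integral_const_mul, intervalIntegral.integral_const_mul] at h0
    · linarith
    all_goals exact Continuous.intervalIntegrable (by fun_prop) _ _
  have := discrim_le_zero key
  unfold discrim at this
  nlinarith

lemma aux_parts1 (p v : ℝ → ℝ) (hp : Continuous p) (hv : Continuous v) :
    ∫ x in (0:ℝ)..1, p x * (∫ t in (0:ℝ)..x, v t) = ∫ x in (0:ℝ)..1, (∫ t in x..1, p t) * v x := by
  have hP : ∀ x, HasDerivAt (fun x => ∫ t in x..1, p t) (-p x) x := fun x =>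
    intervalIntegral.integral_hasDerivAt_left (hp.intervalIntegrable _ _)
      (hp.stronglyMeasurableAtFilter _ _) hp.continuousAt
  have hV : ∀ x, HasDerivAt (fun x => ∫ t in (0:ℝ)..x, v t) (v x) x := fun x =>
    intervalIntegral.integral_hasDerivAt_right (hv.intervalIntegrable _ _)
      (hv.stronglyMeasurableAtFilter _ _) hv.continuousAt
  have := intervalIntegral.integral_mul_deriv_eq_deriv_mul (a := 0) (b := 1)
    (fun x _ => hP x) (fun x _ => hV x) (hp.neg.intervalIntegrable _ _) (hv.intervalIntegrable _ _)
  rw [this]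
  simp

lemma aux_parts2 (p v : ℝ → ℝ) (hp : Continuous p) (hv : Continuous v) :
    ∫ x in (0:ℝ)..1, p x * (∫ t in x..1, v t) = ∫ x in (0:ℝ)..1, (∫ t in (0:ℝ)..x, p t) * v x := by
  have := aux_parts1 v p hv hp
  simp only [mul_comm] at this ⊢
  exact this.symm

lemma aux_unit_s4 (u u1 w k : ℝ → ℝ) (hu : ContinuousOn u (Set.Icc 0 1))
    (hu1 : ContinuousOn u1 (Set.Icc 0 1)) (hw : Continuous w) (hk : Continuous k)
    (hk0 : ∀ x, 0 ≤ k x)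
    (hd : ∀ x ∈ Set.Ioo (0:ℝ) 1, HasDerivAt u (u1 x) x)
    (hd1 : ∀ x ∈ Set.Ioo (0:ℝ) 1, HasDerivAt u1 (w x) x) :
    ∫ x in (0:ℝ)..1, ((1 - x) * u 0 + x * u 1 - u x) ^ 2 * k x ≤
      2 * ∫ x in (0:ℝ)..1, ((∫ t in (0:ℝ)..x, k t * (t ^ 2 * (1 - t) ^ 3 / 3))
        + (∫ t in x..1, k t * ((1 - t) ^ 2 * t ^ 3 / 3))) * w x ^ 2 := by
  have cI : ∀ v : ℝ → ℝ, Continuous v → Continuous (fun x => ∫ t in (0:ℝ)..x, v t) :=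
    fun v hv => intervalIntegral.continuous_primitive (fun _ _ => hv.intervalIntegrable _ _) _
  have cJ : ∀ v : ℝ → ℝ, Continuous v → Continuous (fun x => ∫ t in x..1, v t) := by
    intro v hv
    have : (fun x => ∫ t in x..1, v t) = fun x => - ∫ t in (1:ℝ)..x, v t := by
      ext x; rw [intervalIntegral.integral_symm]
    rw [this]
    exact (intervalIntegral.continuous_primitive (fun _ _ => hv.intervalIntegrable _ _) _).neg
  have hw2 : Continuous (fun x => w x ^ 2) := by fun_prop
  have hp : Continuous (fun t : ℝ => k t * (t ^ 2 * (1 - t) ^ 3 / 3)) := by fun_prop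
  have hq : Continuous (fun t : ℝ => k t * ((1 - t) ^ 2 * t ^ 3 / 3)) := by fun_prop
  have c1 := cI _ hw2
  have c2 := cJ _ hw2
  have c3 := cI _ hp
  have c4 := cJ _ hq
  have e1 := aux_parts2 _ _ hp hw2
  have e2 := aux_parts1 _ _ hq hw2
  have rhs : (∫ x in (0:ℝ)..1, ((∫ t in (0:ℝ)..x, k t * (t ^ 2 * (1 - t) ^ 3 / 3))
        + (∫ t in x..1, k t * ((1 - t) ^ 2 * t ^ 3 / 3))) * w x ^ 2)
      = ∫ x in (0:ℝ)..1, ((k x * (x ^ 2 * (1 - x) ^ 3 / 3)) * (∫ t in x..1, w t ^ 2)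
        + (k x * ((1 - x) ^ 2 * x ^ 3 / 3)) * (∫ t in (0:ℝ)..x, w t ^ 2)) := by
    rw [intervalIntegral.integral_add, e1, e2, ← intervalIntegral.integral_add]
    · congr 1; ext x; ring
    · exact (c3.mul hw2).intervalIntegrable _ _
    · exact (c4.mul hw2).intervalIntegrable _ _
    · exact (hp.mul c2).intervalIntegrable _ _
    · exact (hq.mul c1).intervalIntegrable _ _
  rw [rhs, ← intervalIntegral.integral_const_mul]
  apply intervalIntegral.integral_mono_on zero_le_one
  · apply ContinuousOn.intervalIntegrable
    rw [Set.uIcc_of_le zero_le_one]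
    have hkc := hk.continuousOn (s := Set.Icc (0:ℝ) 1)
    fun_prop
  · exact (((hp.mul c2).add (hq.mul c1)).const_mul 2).intervalIntegrable _ _
  · intro x hx
    obtain ⟨hx0, hx1⟩ := hx
    have i1 : (∫ t in (0:ℝ)..x, t * w t) = (x * u1 x - u x) - (0 * u1 0 - u 0) := by
      apply intervalIntegral.integral_eq_sub_of_hasDerivAt_of_le hx0
        (f := fun t => t * u1 t - u t)
      · have h1 := hu.mono (Set.Icc_subset_Icc_right hx1)
        have h2 := hu1.mono (Set.Icc_subset_Icc_right hx1)
        fun_prop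
      · intro t ht
        have ht' : t ∈ Set.Ioo (0:ℝ) 1 := ⟨ht.1, ht.2.trans_le hx1⟩
        have := ((hasDerivAt_id t).mul (hd1 t ht')).sub (hd t ht')
        refine this.congr_deriv ?_
        simp
      · exact Continuous.intervalIntegrable (by fun_prop) _ _
    have i2 : (∫ t in x..1, (1 - t) * w t)
        = ((1 - 1) * u1 1 + u 1) - ((1 - x) * u1 x + u x) := by
      apply intervalIntegral.integral_eq_sub_of_hasDerivAt_of_le hx1
        (f := fun t => (1 - t) * u1 t + u t)
      · have h1 := hu.mono (Set.Icc_subset_Icc_left hx0)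
        have h2 := hu1.mono (Set.Icc_subset_Icc_left hx0)
        fun_prop
      · intro t ht
        have ht' : t ∈ Set.Ioo (0:ℝ) 1 := ⟨hx0.trans_lt ht.1, ht.2⟩
        have := (((hasDerivAt_id t).const_sub 1).mul (hd1 t ht')).add (hd t ht')
        refine this.congr_deriv ?_
        simp
      · exact Continuous.intervalIntegrable (by fun_prop) _ _
    have b1 := aux_cs_s4 (fun t => t) w continuous_id hw 0 x hx0
    have b2 := aux_cs_s4 (fun t => 1 - t) w (by fun_prop) hw x 1 hx1
    have s1 : (∫ t in (0:ℝ)..x, t ^ 2) = x ^ 3 / 3 := by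
      rw [integral_pow]; norm_num
    have s2 : (∫ t in x..1, (1 - t) ^ 2) = (1 - x) ^ 3 / 3 := by
      rw [intervalIntegral.integral_comp_sub_left (fun t => t ^ 2) 1, integral_pow]; norm_num
    rw [s1] at b1
    rw [s2] at b2
    set B1 := ∫ t in (0:ℝ)..x, t * w t
    set B2 := ∫ t in x..1, (1 - t) * w t
    set W1 := ∫ t in (0:ℝ)..x, w t ^ 2
    set W2 := ∫ t in x..1, w t ^ 2
    have e : (1 - x) * u 0 + x * u 1 - u x = (1 - x) * B1 + x * B2 := by
      rw [i1, i2]; ring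
    rw [e]
    have hsq : ((1 - x) * B1 + x * B2) ^ 2
        ≤ 2 * ((1 - x) ^ 2 * (x ^ 3 / 3 * W1) + x ^ 2 * ((1 - x) ^ 3 / 3 * W2)) := by
      have m1 := mul_le_mul_of_nonneg_left b1 (sq_nonneg (1 - x))
      have m2 := mul_le_mul_of_nonneg_left b2 (sq_nonneg x)
      nlinarith [sq_nonneg ((1 - x) * B1 - x * B2)]
    have := mul_le_mul_of_nonneg_right hsq (hk0 x)
    refine this.trans (le_of_eq ?_)
    ring

lemma aux_cell (f g : ℝ → ℝ) (a b : ℝ) (hab : a < b)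
    (hf : ContDiffOn ℝ 2 f (Set.Icc a b)) (hg0 : ∀ S ∈ Set.Icc a b, 0 ≤ g S)
    (hgc : ContinuousOn g (Set.Icc a b)) :
    ∫ S in a..b, (splineL f a b S - f S) ^ 2 * g S ≤ 2 * ((b - a) ^ 4 * curvInt f g a b) := by
  have hh : 0 < b - a := sub_pos.2 hab
  set h := b - a with hdef
  set I := Set.Icc a b with hI
  have hud : UniqueDiffOn ℝ I := uniqueDiffOn_Icc hab
  set D1 := derivWithin f I with hD1
  set D2 := derivWithin D1 I with hD2
  have hc1 : ContDiffOn ℝ 1 D1 I := hf.derivWithin hud (by norm_num)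
  have hc2 : ContDiffOn ℝ 0 D2 I := hc1.derivWithin hud (by norm_num)
  have hd1 : ∀ x ∈ Set.Ioo a b, HasDerivAt f (D1 x) x := fun x hx =>
    ((hf.differentiableOn (by norm_num) x (Set.Ioo_subset_Icc_self hx)).hasDerivWithinAt).hasDerivAt
      (Icc_mem_nhds hx.1 hx.2)
  have hd2 : ∀ x ∈ Set.Ioo a b, HasDerivAt D1 (D2 x) x := fun x hx =>
    ((hc1.differentiableOn (by norm_num) x (Set.Ioo_subset_Icc_self hx)).hasDerivWithinAt).hasDerivAt
      (Icc_mem_nhds hx.1 hx.2)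
  have hdd : ∀ x ∈ Set.Ioo a b, deriv (deriv f) x = D2 x := by
    intro x hx
    have : deriv f =ᶠ[nhds x] D1 := by
      filter_upwards [Ioo_mem_nhds hx.1 hx.2] with y hy using (hd1 y hy).deriv
    rw [this.deriv_eq, (hd2 x hx).deriv]
  -- clamp
  let c : ℝ → ℝ := fun x => a + h * max 0 (min 1 x)
  have hcc : Continuous c := by fun_prop
  have hcm : ∀ x, c x ∈ I := by
    intro x
    have h0 : 0 ≤ max 0 (min 1 x) := le_max_left _ _
    have h1 : max 0 (min 1 x) ≤ 1 := max_le zero_le_one (min_le_left _ _)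
    constructor
    · have := mul_nonneg hh.le h0
      simp only [c]; linarith
    · have := mul_le_mul_of_nonneg_left h1 hh.le
      simp only [c]; linarith
  have hce : ∀ x ∈ Set.Icc (0:ℝ) 1, c x = a + h * x := by
    intro x hx; simp only [c]; rw [min_eq_right hx.2, max_eq_right hx.1]
  have hmaps : Set.MapsTo (fun x => a + h * x) (Set.Icc (0:ℝ) 1) I := by
    intro x hx; have := hcm x; rwa [hce x hx] at this
  have hmapo : ∀ x ∈ Set.Ioo (0:ℝ) 1, a + h * x ∈ Set.Ioo a b := by
    intro x hx
    have h1 := mul_pos hh hx.1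
    have h2 := mul_lt_mul_of_pos_left hx.2 hh
    constructor <;> linarith
  have haff : ∀ x, HasDerivAt (fun x : ℝ => a + h * x) h x := by
    intro x
    simpa using ((hasDerivAt_id x).const_mul h).const_add a
  have hafc : ContinuousOn (fun x : ℝ => a + h * x) (Set.Icc (0:ℝ) 1) := by fun_prop
  have main := aux_unit_s4 (fun x => f (a + h * x)) (fun x => h * D1 (a + h * x))
    (fun x => h ^ 2 * D2 (c x)) (fun x => g (c x))
    (hf.continuousOn.comp hafc hmaps)
    (continuousOn_const.mul (hc1.continuousOn.comp hafc hmaps))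
    (continuous_const.mul (hc2.continuousOn.comp_continuous hcc hcm))
    (hgc.comp_continuous hcc hcm) (fun x => hg0 _ (hcm x))
    (by
      intro x hx
      have := (hd1 _ (hmapo x hx)).comp x (haff x)
      refine this.congr_deriv (by ring))
    (by
      intro x hx
      have := ((hd2 _ (hmapo x hx)).comp x (haff x)).const_mul h
      refine this.congr_deriv ?_
      rw [hce x (Set.Ioo_subset_Icc_self hx)]; ring)
  -- left side
  have hb : a + h * 1 = b := by rw [hdef]; ring
  have L : (∫ S in a..b, (splineL f a b S - f S) ^ 2 * g S)
      = h * ∫ x in (0:ℝ)..1, ((1 - x) * f (a + h * 0) + x * f (a + h * 1) - f (a + h * x)) ^ 2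
          * g (c x) := by
    have := intervalIntegral.mul_integral_comp_add_mul (a := 0) (b := 1)
      (f := fun S => (splineL f a b S - f S) ^ 2 * g S) h a
    rw [hb, mul_zero, add_zero] at this
    rw [← this]
    congr 1
    apply intervalIntegral.integral_congr
    intro x hx
    rw [Set.uIcc_of_le zero_le_one] at hx
    simp only
    rw [hce x hx]
    have q1 : (b - (a + h * x)) / (b - a) = 1 - x := by
      rw [← hdef, div_eq_iff hh.ne', hdef]; ring
    have q2 : (a + h * x - a) / (b - a) = x := by
      rw [← hdef, div_eq_iff hh.ne']; ring
    unfold splineL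
    rw [q1, q2, hb, mul_zero, add_zero]
  have R : curvInt f g a b * h ^ 4 = h * ∫ x in (0:ℝ)..1,
      ((∫ t in (0:ℝ)..x, g (c t) * (t ^ 2 * (1 - t) ^ 3 / 3))
        + (∫ t in x..1, g (c t) * ((1 - t) ^ 2 * t ^ 3 / 3))) * (h ^ 2 * D2 (c x)) ^ 2 := by
    have := intervalIntegral.mul_integral_comp_add_mul (a := 0) (b := 1)
      (f := fun S => weightG g a b S * (deriv (deriv f) S) ^ 2) h a
    rw [hb, mul_zero, add_zero] at this
    unfold curvInt
    rw [← this, mul_assoc, ← intervalIntegral.integral_mul_const]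
    congr 1
    apply intervalIntegral.integral_congr_ae
    have hne : ∀ᵐ x : ℝ, x ≠ 1 := by simp [ae_iff]
    filter_upwards [hne] with x hx1 hx
    rw [Set.uIoc_of_le zero_le_one] at hx
    have hxo : x ∈ Set.Ioo (0:ℝ) 1 := ⟨hx.1, lt_of_le_of_ne hx.2 hx1⟩
    have hxc := Set.Ioo_subset_Icc_self hxo
    rw [hdd _ (hmapo x hxo), hce x hxc]
    have q2 : (a + h * x - a) / (b - a) = x := by
      rw [← hdef, div_eq_iff hh.ne']; ring
    unfold weightG
    rw [q2, ← hdef]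
    have j1 : (∫ t in (0:ℝ)..x, g (c t) * (t ^ 2 * (1 - t) ^ 3 / 3))
        = ∫ t in (0:ℝ)..x, g (a + h * t) * (t ^ 2 * (1 - t) ^ 3 / 3) := by
      apply intervalIntegral.integral_congr
      intro t ht
      rw [Set.uIcc_of_le hxc.1] at ht
      simp only
      rw [hce t ⟨ht.1, ht.2.trans hxc.2⟩]
    have j2 : (∫ t in x..1, g (c t) * ((1 - t) ^ 2 * t ^ 3 / 3))
        = ∫ t in x..1, g (a + h * t) * ((1 - t) ^ 2 * t ^ 3 / 3) := by
      apply intervalIntegral.integral_congr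
      intro t ht
      rw [Set.uIcc_of_le hxc.2] at ht
      simp only
      rw [hce t ⟨hxc.1.trans ht.1, ht.2⟩]
    rw [j1, j2]
    ring
  rw [L, mul_comm (h ^ 4), R]
  have := mul_le_mul_of_nonneg_left main hh.le
  linarith

lemma aux_curv_nonneg (f g : ℝ → ℝ) (a b : ℝ) (hab : a < b)
    (hg0 : ∀ S ∈ Set.Icc a b, 0 ≤ g S) : 0 ≤ curvInt f g a b := by
  have hh : 0 < b - a := sub_pos.2 hab
  unfold curvInt
  apply intervalIntegral.integral_nonneg hab.le
  intro S hS
  refine mul_nonneg ?_ (sq_nonneg _)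
  have hx0 : 0 ≤ (S - a) / (b - a) := div_nonneg (sub_nonneg.2 hS.1) hh.le
  have hx1 : (S - a) / (b - a) ≤ 1 := (div_le_one hh).2 (by linarith [hS.2])
  have hgp : ∀ t : ℝ, 0 ≤ t → t ≤ 1 → 0 ≤ g (a + (b - a) * t) := by
    intro t h0 h1
    apply hg0
    have m0 := mul_nonneg hh.le h0
    have m1 := mul_le_mul_of_nonneg_left h1 hh.le
    constructor <;> linarith
  unfold weightG
  refine add_nonneg ?_ ?_
  · apply intervalIntegral.integral_nonneg hx0
    intro t ht
    have h1 : 0 ≤ 1 - t := by linarith [ht.2]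
    have h0 := ht.1
    exact mul_nonneg (hgp t ht.1 (by linarith)) (by positivity)
  · apply intervalIntegral.integral_nonneg hx1
    intro t ht
    have h1 : 0 ≤ 1 - t := by linarith [ht.2]
    have h0 : 0 ≤ t := hx0.trans ht.1
    exact mul_nonneg (hgp t h0 (by linarith)) (by positivity)

/-- For every `γ ∈ (0, 2]`, the weighted squared spline-approximation error satisfies
`Σ_i ∫_{X_i}^{X_{i+1}} (L_i(S) − f(S))² g(S) dS ≤ 2 α_h Σ_i h_i⁵ ρ_i^{2/γ}`. -/
theorem weighted_error_alpha_rho_bound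
    (n : ℕ) (hn : 1 ≤ n) (X : ℕ → ℝ) (hX0 : 0 < X 0)
    (hXmono : ∀ i < n, X i < X (i + 1))
    (f g : ℝ → ℝ)
    (hf : ContinuousOn f (Set.Icc (X 0) (X n)))
    (hf2 : ∀ i < n, ContDiffOn ℝ 2 f (Set.Icc (X i) (X (i + 1))))
    (hg0 : ∀ S ∈ Set.Icc (X 0) (X n), 0 ≤ g S)
    (hgc : ContinuousOn g (Set.Icc (X 0) (X n)))
    (γ : ℝ) (hγ0 : 0 < γ) (hγ2 : γ ≤ 2)
    (hα : 0 < alphaH f g γ n X) :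
    ∑ i ∈ Finset.range n,
        ∫ S in (X i)..(X (i + 1)), (splineL f (X i) (X (i + 1)) S - f S) ^ 2 * g S
      ≤ 2 * alphaH f g γ n X * ∑ i ∈ Finset.range n,
          (X (i + 1) - X i) ^ 5 * rhoAdapt f g γ n X i ^ (2 / γ) := by
  have hmono : ∀ j ≤ n, ∀ i ≤ j, X i ≤ X j := by
    intro j
    induction j with
    | zero => intro _ i hi; rw [Nat.le_zero.1 hi]
    | succ j ih =>
      intro hj i hi
      rcases Nat.lt_or_ge i (j + 1) with h | h
      · exact (ih (by omega) i (by omega)).trans (hXmono j (by omega)).le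
      · rw [le_antisymm hi h]
  rw [Finset.mul_sum]
  apply Finset.sum_le_sum
  intro i hi
  have hin : i < n := Finset.mem_range.1 hi
  have hab := hXmono i hin
  have hsub : Set.Icc (X i) (X (i + 1)) ⊆ Set.Icc (X 0) (X n) :=
    Set.Icc_subset_Icc (hmono i hin.le 0 (Nat.zero_le _)) (hmono n le_rfl (i + 1) hin)
  have hgi : ∀ S ∈ Set.Icc (X i) (X (i + 1)), 0 ≤ g S := fun S hS => hg0 S (hsub hS)
  have cell := aux_cell f g _ _ hab (hf2 i hin) hgi (hgc.mono hsub)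
  have hC := aux_curv_nonneg f g _ _ hab hgi
  have hh : 0 < X (i + 1) - X i := sub_pos.2 hab
  refine cell.trans ?_
  unfold rhoAdapt
  generalize alphaH f g γ n X = A at *
  generalize curvInt f g (X i) (X (i + 1)) = C at *
  generalize X (i + 1) - X i = h at *
  have hb : 0 ≤ 1 + 1 / (A * h) * C := by positivity
  rw [← Real.rpow_mul hb, show γ / 2 * (2 / γ) = 1 by field_simp, Real.rpow_one]
  have : 2 * A * (h ^ 5 * (1 + 1 / (A * h) * C)) = 2 * A * h ^ 5 + 2 * (h ^ 4 * C) := by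
    field_simp
  rw [this]
  have : 0 < 2 * A * h ^ 5 := by positivity
  linarith
end
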